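/- arXiv:1812.08965 — 3 statements merged into one kernel-verified Lean document; each statement's English description precedes it below -/
import Mathlib

section
/- (Informed adversarial construction attains the FDP bound.) Fix α ∈ (0,1), integers n_0 ≥ 1 and n_1 ≥ 0 with n = n_0 + n_1, and null values q_1,…,q_{n_0} ∈ (0,1] with order statistics q_(1) ≤ ⋯ ≤ q_(n_0). Let j* be the largest maximizer over 1 ≤ j ≤ n_0 of j/⌈n·q_(j)/α⌉. Suppose ⌈n·q_(j*)/α⌉ − j* ≤ n_1, and form n p-values consisting of q_1,…,q_{n_0} together with max{⌈n·q_(j*)/α⌉ − j*, 0} non-null p-values equal to 0 and the remaining non-null p-values equal to 1. Then the Benjamini–Hochberg procedure at level α applied to these n p-values yields FDP = min{ max_{1≤j≤n_0} j/⌈n·q_(j)/α⌉, 1 }, where FDP is the number of rejected q's divided by max{total rejections, 1}. -/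
open MeasureTheory Finset

attribute [local instance] Classical.propDecidable

/-- Number of rejections of the Benjamini–Hochberg (step-up) procedure at level `α`
applied to the family of p-values `p` indexed by `ι`: the largest `j` such that the
`j`-th smallest p-value is at most `α j / n` (equivalently, at least `j` of the
p-values are at most `α j / n`), and `0` if there is no such `j ≥ 1`. -/
noncomputable def bhNumRejections {ι : Type*} [Fintype ι] (α : ℝ) (p : ι → ℝ) : ℕ :=
  Nat.findGreatest
    (fun j => j ≤ (Finset.univ.filter (fun i => p i ≤ α * (j : ℝ) / (Fintype.card ι : ℝ))).card)
    (Fintype.card ι)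

/-- False discovery proportion `V / max{R, 1}` of the BH procedure at level `α`
with set of true null hypotheses `N₀`. -/
noncomputable def bhFDP {ι : Type*} [Fintype ι] (α : ℝ) (N₀ : Finset ι) (p : ι → ℝ) : ℝ :=
  ((N₀.filter (fun i => p i ≤ α * (bhNumRejections α p : ℝ) / (Fintype.card ι : ℝ))).card : ℝ) /
    ((max (bhNumRejections α p) 1 : ℕ) : ℝ)

/-- False discovery rate (expected FDP) of the BH procedure at level `α`. -/
noncomputable def bhFDR {Ω : Type*} [MeasurableSpace Ω] {ι : Type*} [Fintype ι]
    (μ : Measure Ω) (α : ℝ) (N₀ : Finset ι) (p : ι → Ω → ℝ) : ℝ :=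
  ∫ ω, bhFDP α N₀ (fun i => p i ω) ∂μ

/-- `orderStat s p j` is the `j`-th smallest value (1-indexed, for `1 ≤ j ≤ |s|`)
among the family `(p i)_{i ∈ s}`: the least `c` such that at least `j` of the values
are at most `c`. -/
noncomputable def orderStat {ι : Type*} (s : Finset ι) (p : ι → ℝ) (j : ℕ) : ℝ :=
  sInf {c : ℝ | j ≤ (s.filter fun i => p i ≤ c).card}

/-- The Simes statistic `min_{1 ≤ j ≤ |s|} |s| ⋅ p_(j) / j` of the family
`(p i)_{i ∈ s}`. -/
noncomputable def simesStat {ι : Type*} (s : Finset ι) (p : ι → ℝ) : ℝ :=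
  ⨅ j : {j : ℕ // 1 ≤ j ∧ j ≤ s.card}, (s.card : ℝ) * orderStat s p j.1 / (j.1 : ℝ)

/-- The ratio `j / ⌈n ⋅ q_(j) / α⌉` appearing in the FDP bound, where `q_(j)` is the
`j`-th smallest of the null values `q`. -/
noncomputable def bhRatio (α : ℝ) (n : ℕ) {n₀ : ℕ} (q : Fin n₀ → ℝ) (j : ℕ) : ℝ :=
  (j : ℝ) / ((Nat.ceil ((n : ℝ) * orderStat Finset.univ q j / α) : ℕ) : ℝ)

/-- The largest maximizer `j*` over `1 ≤ j ≤ n₀` of `j / ⌈n ⋅ q_(j) / α⌉`. -/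
noncomputable def jStar (α : ℝ) (n : ℕ) {n₀ : ℕ} (q : Fin n₀ → ℝ) : ℕ :=
  Nat.findGreatest
    (fun j => 1 ≤ j ∧ ∀ j' : ℕ, 1 ≤ j' → j' ≤ n₀ → bhRatio α n q j' ≤ bhRatio α n q j) n₀

theorem exists_isLeast_card_filter_le {ι : Type*} (s : Finset ι) (p : ι → ℝ) {j : ℕ}
    (hj : 1 ≤ j) (hjs : j ≤ s.card) :
    ∃ i ∈ s, IsLeast {c : ℝ | j ≤ (s.filter fun i => p i ≤ c).card} (p i) := by
  have key : ∀ c : ℝ, j ≤ (s.filter fun i => p i ≤ c).card →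
      ∃ i ∈ s, p i ≤ c ∧ j ≤ (s.filter fun l => p l ≤ p i).card := by
    intro c hc
    have hne : (s.filter fun i => p i ≤ c).Nonempty := Finset.card_pos.mp (by omega)
    obtain ⟨i, hi, hmax⟩ := Finset.exists_max_image _ p hne
    rw [Finset.mem_filter] at hi
    refine ⟨i, hi.1, hi.2, hc.trans (Finset.card_le_card fun l hl => ?_)⟩
    exact Finset.mem_filter.mpr ⟨(Finset.mem_filter.mp hl).1, hmax l hl⟩
  have hs : s.Nonempty := Finset.card_pos.mp (by omega)
  obtain ⟨i₀, -, hi₀⟩ := Finset.exists_max_image s p hs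
  obtain ⟨i₁, hi₁s, -, hi₁⟩ := key (p i₀) (by
    rwa [Finset.filter_true_of_mem hi₀])
  obtain ⟨i, hi, hmin⟩ := Finset.exists_min_image
    (s.filter fun i => j ≤ (s.filter fun l => p l ≤ p i).card) p
    ⟨i₁, Finset.mem_filter.mpr ⟨hi₁s, hi₁⟩⟩
  rw [Finset.mem_filter] at hi
  refine ⟨i, hi.1, hi.2, fun c hc => ?_⟩
  obtain ⟨l, hls, hlc, hl⟩ := key c hc
  exact (hmin l (Finset.mem_filter.mpr ⟨hls, hl⟩)).trans hlc

theorem isLeast_orderStat {ι : Type*} (s : Finset ι) (p : ι → ℝ) {j : ℕ}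
    (hj : 1 ≤ j) (hjs : j ≤ s.card) :
    IsLeast {c : ℝ | j ≤ (s.filter fun i => p i ≤ c).card} (orderStat s p j) := by
  obtain ⟨i, -, h⟩ := exists_isLeast_card_filter_le s p hj hjs
  rwa [orderStat, h.csInf_eq]

theorem orderStat_pos {ι : Type*} (s : Finset ι) (p : ι → ℝ) {j : ℕ}
    (hj : 1 ≤ j) (hjs : j ≤ s.card) (hp : ∀ i ∈ s, 0 < p i) : 0 < orderStat s p j := by
  obtain ⟨i, hi, h⟩ := exists_isLeast_card_filter_le s p hj hjs
  rw [orderStat, h.csInf_eq]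
  exact hp i hi

theorem jStar_spec (α : ℝ) (n : ℕ) {n₀ : ℕ} (hn₀ : 1 ≤ n₀) (q : Fin n₀ → ℝ) :
    1 ≤ jStar α n q ∧ jStar α n q ≤ n₀ ∧
      ∀ j : ℕ, 1 ≤ j → j ≤ n₀ → bhRatio α n q j ≤ bhRatio α n q (jStar α n q) := by
  obtain ⟨j, hj, hmax⟩ := Finset.exists_max_image (Finset.Icc 1 n₀) (bhRatio α n q)
    ⟨1, Finset.mem_Icc.mpr ⟨le_rfl, hn₀⟩⟩
  rw [Finset.mem_Icc] at hj
  have h := Nat.findGreatest_spec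
    (P := fun j => 1 ≤ j ∧ ∀ j' : ℕ, 1 ≤ j' → j' ≤ n₀ → bhRatio α n q j' ≤ bhRatio α n q j)
    hj.2 ⟨hj.1, fun j' h₁ h₂ => hmax j' (Finset.mem_Icc.mpr ⟨h₁, h₂⟩)⟩
  exact ⟨h.1, Nat.findGreatest_le _, h.2⟩

theorem iSup_bhRatio_eq (α : ℝ) (n : ℕ) {n₀ : ℕ} (hn₀ : 1 ≤ n₀) (q : Fin n₀ → ℝ) :
    ⨆ j : {j : ℕ // 1 ≤ j ∧ j ≤ n₀}, bhRatio α n q j.1 = bhRatio α n q (jStar α n q) := by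
  obtain ⟨h₁, h₂, hmax⟩ := jStar_spec α n hn₀ q
  have : Nonempty {j : ℕ // 1 ≤ j ∧ j ≤ n₀} := ⟨⟨_, h₁, h₂⟩⟩
  refine ciSup_eq_of_forall_le_of_forall_lt_exists_gt (fun j => hmax j.1 j.2.1 j.2.2) ?_
  exact fun w hw => ⟨⟨_, h₁, h₂⟩, hw⟩

theorem le_bhNumRejections {ι : Type*} [Fintype ι] {α : ℝ} {p : ι → ℝ} {k : ℕ}
    (h : k ≤ (univ.filter fun i => p i ≤ α * (k : ℝ) / (Fintype.card ι : ℝ)).card) :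
    k ≤ bhNumRejections α p :=
  Nat.le_findGreatest (h.trans (Finset.card_le_univ _)) h

theorem card_filter_le_eq_bhNumRejections {ι : Type*} [Fintype ι] {α : ℝ} (hα : 0 ≤ α)
    (p : ι → ℝ) :
    (univ.filter fun i => p i ≤ α * (bhNumRejections α p : ℝ) / (Fintype.card ι : ℝ)).card =
      bhNumRejections α p := by
  have hle : bhNumRejections α p ≤
      (univ.filter fun i => p i ≤ α * (bhNumRejections α p : ℝ) / (Fintype.card ι : ℝ)).card :=
    Nat.findGreatest_spec
      (P := fun j => j ≤ (univ.filter fun i => p i ≤ α * (j : ℝ) / (Fintype.card ι : ℝ)).card)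
      (Nat.zero_le _) (Nat.zero_le _)
  refine le_antisymm (le_bhNumRejections (Finset.card_le_card fun i hi => ?_)) hle
  rw [Finset.mem_filter] at hi ⊢
  refine ⟨hi.1, hi.2.trans ?_⟩
  gcongr

/-- Appending `m` zeros and `n₁ - m` ones to `q` adds exactly `m` values below any threshold
in `[0, 1)`. -/
theorem card_filter_sumElim_le {n₀ n₁ m : ℕ} (hm : m ≤ n₁) (q : Fin n₀ → ℝ) {t : ℝ}
    (ht : 0 ≤ t) (ht1 : t < 1) :
    (univ.filter fun i : Fin n₀ ⊕ Fin n₁ =>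
      Sum.elim q (fun i : Fin n₁ => if (i : ℕ) < m then (0 : ℝ) else 1) i ≤ t).card =
      (univ.filter fun i => q i ≤ t).card + m := by
  have hcard : (univ.filter fun i : Fin n₁ => (i : ℕ) < m).card = m := by
    simp [Fin.card_filter_val_lt, hm]
  have hzero : ∀ i : Fin n₁, (if (i : ℕ) < m then (0 : ℝ) else 1) ≤ t ↔ (i : ℕ) < m := by
    intro i
    split_ifs with h <;> simp [h, ht, ht1]
  have hsum : (univ.filter fun i : Fin n₀ ⊕ Fin n₁ =>
      Sum.elim q (fun i : Fin n₁ => if (i : ℕ) < m then (0 : ℝ) else 1) i ≤ t) =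
      (univ.filter fun i => q i ≤ t).disjSum (univ.filter fun i : Fin n₁ => (i : ℕ) < m) := by
    ext (i | i) <;> simp [hzero]
  rw [hsum, Finset.card_disjSum, hcard]

/-- **The informed adversarial construction attains the FDP bound.** Given null
values `q₁,…,q_{n₀} ∈ (0,1]` and `n₁` non-null p-values of which
`max{⌈n q_(j*)/α⌉ − j*, 0}` are set to `0` and the rest to `1` (assuming
`⌈n q_(j*)/α⌉ − j* ≤ n₁`), the BH procedure at level `α` on the resulting `n = n₀ + n₁`
p-values has `FDP = min{ max_{1 ≤ j ≤ n₀} j/⌈n q_(j)/α⌉, 1 }`. -/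
theorem informed_adversary_fdp
    {n₀ n₁ : ℕ} (hn₀ : 1 ≤ n₀) {α : ℝ} (hα : 0 < α) (hα1 : α < 1)
    (q : Fin n₀ → ℝ) (hq : ∀ i, q i ∈ Set.Ioc (0:ℝ) 1)
    (hok : Nat.ceil (((n₀ + n₁ : ℕ) : ℝ) * orderStat Finset.univ q (jStar α (n₀ + n₁) q) / α)
            - jStar α (n₀ + n₁) q ≤ n₁)
    (padv : Fin n₀ ⊕ Fin n₁ → ℝ)
    (hpadv : padv = Sum.elim q (fun i : Fin n₁ =>
      if (i : ℕ) <
          Nat.ceil (((n₀ + n₁ : ℕ) : ℝ) * orderStat Finset.univ q (jStar α (n₀ + n₁) q) / α)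
            - jStar α (n₀ + n₁) q
      then 0 else 1)) :
    bhFDP α ((Finset.univ : Finset (Fin n₀)).map ⟨Sum.inl, Sum.inl_injective⟩) padv =
      min (⨆ j : {j : ℕ // 1 ≤ j ∧ j ≤ n₀}, bhRatio α (n₀ + n₁) q j.1) 1 := by
  rw [iSup_bhRatio_eq α _ hn₀ q]
  obtain ⟨hj₁, hj₂, hmax⟩ := jStar_spec α (n₀ + n₁) hn₀ q
  have hratio : bhRatio α (n₀ + n₁) q (jStar α (n₀ + n₁) q) = (jStar α (n₀ + n₁) q : ℝ) /
      (Nat.ceil (((n₀ + n₁ : ℕ) : ℝ) *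
        orderStat Finset.univ q (jStar α (n₀ + n₁) q) / α) : ℕ) := rfl
  have hleast := isLeast_orderStat univ q hj₁ (by simpa using hj₂)
  have hqpos := orderStat_pos univ q hj₁ (by simpa using hj₂) (fun i _ => (hq i).1)
  set M := bhRatio α (n₀ + n₁) q (jStar α (n₀ + n₁) q)
  set j := jStar α (n₀ + n₁) q
  have hn : (0 : ℝ) < (n₀ + n₁ : ℕ) := by exact_mod_cast (by omega : 0 < n₀ + n₁)
  have hk_le := Nat.le_ceil (((n₀ + n₁ : ℕ) : ℝ) * orderStat Finset.univ q j / α)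
  have hk_pos : 0 < Nat.ceil (((n₀ + n₁ : ℕ) : ℝ) * orderStat Finset.univ q j / α) :=
    Nat.ceil_pos.mpr (by positivity)
  set k := Nat.ceil (((n₀ + n₁ : ℕ) : ℝ) * orderStat Finset.univ q j / α)
  have hcardι : Fintype.card (Fin n₀ ⊕ Fin n₁) = n₀ + n₁ := by simp
  have hthr : ∀ r : ℕ, r ≤ n₀ + n₁ → α * (r : ℝ) / (n₀ + n₁ : ℕ) < 1 := by
    intro r hr
    have hr' : (r : ℝ) ≤ (n₀ + n₁ : ℕ) := by exact_mod_cast hr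
    rw [div_lt_one hn]
    nlinarith
  have hcount : ∀ r : ℕ, r ≤ n₀ + n₁ →
      (univ.filter fun i => padv i ≤ α * (r : ℝ) / (Fintype.card (Fin n₀ ⊕ Fin n₁) : ℝ)).card =
        (univ.filter fun i => q i ≤ α * (r : ℝ) / (n₀ + n₁ : ℕ)).card + (k - j) := by
    intro r hr
    rw [hcardι, hpadv]
    exact card_filter_sumElim_le hok q (by positivity) (hthr r hr)
  have hkR : k ≤ bhNumRejections α padv := by
    refine le_bhNumRejections ?_
    rw [hcount k (by omega)]
    have hmem : orderStat univ q j ≤ α * (k : ℝ) / (n₀ + n₁ : ℕ) := by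
      rw [div_le_iff₀ hα] at hk_le
      rw [le_div_iff₀ hn]
      linarith
    have : j ≤ (univ.filter fun i => q i ≤ α * (k : ℝ) / (n₀ + n₁ : ℕ)).card :=
      hleast.1.trans (Finset.card_le_card
        (Finset.monotone_filter_right _ fun i _ hi => hi.trans hmem))
    omega
  have hRn : bhNumRejections α padv ≤ n₀ + n₁ := hcardι ▸ Nat.findGreatest_le _
  have hR := card_filter_le_eq_bhNumRejections hα.le padv
  rw [hcount _ hRn] at hR
  have hV : bhFDP α ((Finset.univ : Finset (Fin n₀)).map ⟨Sum.inl, Sum.inl_injective⟩) padv =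
      ((univ.filter fun i => q i ≤ α * (bhNumRejections α padv : ℝ) / (n₀ + n₁ : ℕ)).card : ℝ) /
        (bhNumRejections α padv : ℝ) := by
    rw [bhFDP, max_eq_left (by omega), hcardι, Finset.filter_map, Finset.card_map]
    simp [hpadv, Function.comp_def]
  rw [hV]
  set R := bhNumRejections α padv
  set v := (univ.filter fun i => q i ≤ α * (R : ℝ) / (n₀ + n₁ : ℕ)).card with hv
  have hRpos : (0 : ℝ) < R := by exact_mod_cast hk_pos.trans_le hkR
  have hkpos' : (0 : ℝ) < k := by exact_mod_cast hk_pos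
  have hRv : (v : ℝ) + (k - j : ℕ) = R := by exact_mod_cast hR
  have hvM : (v : ℝ) / R ≤ M := by
    rcases Nat.eq_zero_or_pos v with h0 | hvpos
    · rw [h0, hratio]
      simp only [Nat.cast_zero, zero_div]
      positivity
    have hvn : v ≤ n₀ := by simpa using Finset.card_filter_le (univ : Finset (Fin n₀)) _
    have hcv : orderStat univ q v ≤ α * (R : ℝ) / (n₀ + n₁ : ℕ) :=
      (isLeast_orderStat univ q hvpos (by simpa using hvn)).2 hv.le
    have hvpos' := orderStat_pos univ q hvpos (by simpa using hvn) (fun i _ => (hq i).1)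
    refine le_trans ?_ (hmax v hvpos hvn)
    rw [bhRatio]
    have hc : Nat.ceil (((n₀ + n₁ : ℕ) : ℝ) * orderStat univ q v / α) ≤ R := by
      rw [Nat.ceil_le, div_le_iff₀ hα]
      rw [le_div_iff₀ hn] at hcv
      linarith
    have hcpos : 0 < Nat.ceil (((n₀ + n₁ : ℕ) : ℝ) * orderStat univ q v / α) :=
      Nat.ceil_pos.mpr (by positivity)
    gcongr
  refine le_antisymm (le_min hvM ?_) ?_
  · rw [div_le_one hRpos]
    have : (0 : ℝ) ≤ (k - j : ℕ) := Nat.cast_nonneg _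
    linarith
  · rcases le_total k j with hkj | hjk
    · rw [Nat.sub_eq_zero_of_le hkj, Nat.cast_zero, add_zero] at hRv
      rw [hRv, div_self hRpos.ne']
      exact min_le_right _ _
    · refine (min_le_left _ _).trans ?_
      rw [hratio, div_le_div_iff₀ hkpos' hRpos]
      rw [Nat.cast_sub hjk] at hRv
      have h₁ : (k : ℝ) ≤ R := by exact_mod_cast hkR
      have h₂ : (j : ℝ) ≤ k := by exact_mod_cast hjk
      nlinarith [mul_nonneg (sub_nonneg.mpr h₁) (sub_nonneg.mpr h₂)]
end

section
/- (Improved bound under arbitrary dependence.) Assume only that the null p-values are super-uniform, with arbitrary joint dependence of all p-values. Then every multiple testing procedure compliant at level α ∈ (0,1) satisfies: FDR ≤ 1 if α ≥ 1/(π_0·S(n_0)), and FDR ≤ S(n_0)·π_0·α·log( e/(S(n_0)·π_0·α) ) if α < 1/(π_0·S(n_0)), where S(m) = 1 + 1/2 + ⋯ + 1/m. -/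
open MeasureTheory Finset

attribute [local instance] Classical.propDecidable

/-- False discovery proportion `V / max{R,1}` of a multiple testing procedure with
rejection set `Rset`, where `N₀` is the set of true null hypotheses. -/
noncomputable def procFDP {ι : Type*} (N₀ Rset : Finset ι) : ℝ :=
  ((Rset ∩ N₀).card : ℝ) / ((max Rset.card 1 : ℕ) : ℝ)

/-- A rejection set `Rset` is compliant at level `α` if every rejected p-value `p j`
satisfies `p j ≤ α ⋅ |Rset| / n`. -/
def IsCompliant {ι : Type*} [Fintype ι] (α : ℝ) (p : ι → ℝ) (Rset : Finset ι) : Prop :=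
  ∀ j ∈ Rset, p j ≤ α * (Rset.card : ℝ) / (Fintype.card ι : ℝ)

/-- The harmonic sum `S(m) = 1 + 1/2 + ⋯ + 1/m`. -/
noncomputable def harmonicSum (m : ℕ) : ℝ := ∑ k ∈ Finset.range m, 1 / ((k : ℝ) + 1)

/-- A step function dominating `1 / j` on `{y ≤ x * j / (m + 1)}` for every `j ≤ m + 1`, whose
mean under any super-uniform law is at most `x * harmonicSum (m + 1) / (m + 1)`. -/
noncomputable def hommelWeight (m : ℕ) (x y : ℝ) : ℝ :=
  (∑ k ∈ range m, (1 / ((k : ℝ) + 1) - 1 / ((k : ℝ) + 2)) *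
    (Set.Iic (x * ((k : ℝ) + 1) / ((m : ℝ) + 1))).indicator 1 y) +
  1 / ((m : ℝ) + 1) * (Set.Iic x).indicator 1 y

lemma one_div_succ_sub_nonneg (k : ℕ) : 0 ≤ 1 / ((k : ℝ) + 1) - 1 / ((k : ℝ) + 2) := by
  rw [sub_nonneg]
  gcongr
  norm_num

lemma hommelWeight_nonneg (m : ℕ) (x y : ℝ) : 0 ≤ hommelWeight m x y := by
  unfold hommelWeight
  have h (s : Set ℝ) : (0 : ℝ) ≤ s.indicator 1 y := Set.indicator_nonneg (by simp) y
  exact add_nonneg (sum_nonneg fun k _ => mul_nonneg (one_div_succ_sub_nonneg k) (h _))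
    (mul_nonneg (by positivity) (h _))

lemma measurable_hommelWeight (m : ℕ) (x : ℝ) : Measurable (hommelWeight m x) := by
  unfold hommelWeight
  have h (a : ℝ) : Measurable ((Set.Iic a).indicator (1 : ℝ → ℝ)) :=
    measurable_one.indicator measurableSet_Iic
  fun_prop

lemma one_div_le_hommelWeight {m j : ℕ} (hj : j ≤ m) {x y : ℝ} (hx : 0 ≤ x)
    (hy : y ≤ x * ((j : ℝ) + 1) / ((m : ℝ) + 1)) : 1 / ((j : ℝ) + 1) ≤ hommelWeight m x y := by
  have hjm : (j : ℝ) ≤ m := by exact_mod_cast hj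
  have hyx : y ≤ x := by
    refine hy.trans ?_
    rw [div_le_iff₀ (by positivity)]
    gcongr
  have tele : ∑ k ∈ Ico j m, (1 / ((k : ℝ) + 1) - 1 / ((k : ℝ) + 2))
      = 1 / ((j : ℝ) + 1) - 1 / ((m : ℝ) + 1) := by
    have := sum_Ico_sub (fun k : ℕ => - (1 / ((k : ℝ) + 1))) hj
    rw [← neg_sub_neg, ← this]
    refine sum_congr rfl fun k _ => ?_
    push_cast
    ring
  have hsub : ∑ k ∈ Ico j m, (1 / ((k : ℝ) + 1) - 1 / ((k : ℝ) + 2)) ≤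
      ∑ k ∈ range m, (1 / ((k : ℝ) + 1) - 1 / ((k : ℝ) + 2)) *
        (Set.Iic (x * ((k : ℝ) + 1) / ((m : ℝ) + 1))).indicator 1 y := by
    rw [range_eq_Ico]
    refine le_trans (le_of_eq (sum_congr rfl fun k hk => ?_))
      (sum_le_sum_of_subset_of_nonneg (Ico_subset_Ico_left (Nat.zero_le j)) fun k _ _ =>
        mul_nonneg (one_div_succ_sub_nonneg k) (Set.indicator_nonneg (by simp) y))
    have hjk : (j : ℝ) ≤ k := by exact_mod_cast (mem_Ico.1 hk).1
    rw [Set.indicator_of_mem, Pi.one_apply, mul_one]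
    refine hy.trans ?_
    gcongr
  unfold hommelWeight
  rw [Set.indicator_of_mem (show y ∈ Set.Iic x from hyx), Pi.one_apply]
  linarith

lemma integrable_hommelWeight_comp {Ω : Type*} [MeasurableSpace Ω] (μ : Measure Ω)
    [IsProbabilityMeasure μ] {q : Ω → ℝ} (hq : Measurable q) (m : ℕ) (x : ℝ) :
    Integrable (fun ω => hommelWeight m x (q ω)) μ := by
  have h (a : ℝ) : Integrable (fun ω => (Set.Iic a).indicator (1 : ℝ → ℝ) (q ω)) μ :=
    (integrable_const (1 : ℝ)).indicator (hq measurableSet_Iic)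
  exact (integrable_finsetSum _ fun k _ => (h _).const_mul _).add ((h _).const_mul _)

lemma integral_hommelWeight_le {Ω : Type*} [MeasurableSpace Ω] (μ : Measure Ω)
    [IsProbabilityMeasure μ] {q : Ω → ℝ} (hq : Measurable q)
    (hsup : ∀ t ∈ Set.Icc (0 : ℝ) 1, μ {ω | q ω ≤ t} ≤ ENNReal.ofReal t) (m : ℕ)
    {x : ℝ} (hx : x ∈ Set.Icc (0 : ℝ) 1) :
    ∫ ω, hommelWeight m x (q ω) ∂μ ≤ x * harmonicSum (m + 1) / ((m : ℝ) + 1) := by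
  have hint (a : ℝ) : Integrable (fun ω => (Set.Iic a).indicator (1 : ℝ → ℝ) (q ω)) μ :=
    (integrable_const (1 : ℝ)).indicator (hq measurableSet_Iic)
  have hle (a : ℝ) (ha : a ∈ Set.Icc (0 : ℝ) 1) :
      ∫ ω, (Set.Iic a).indicator (1 : ℝ → ℝ) (q ω) ∂μ ≤ a := by
    have : ∫ ω, (Set.Iic a).indicator (1 : ℝ → ℝ) (q ω) ∂μ = μ.real {ω | q ω ≤ a} :=
      integral_indicator_one (hq measurableSet_Iic)
    rw [this]
    exact ENNReal.toReal_le_of_le_ofReal ha.1 (hsup a ha)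
  unfold hommelWeight
  rw [integral_add (integrable_finsetSum _ fun k _ => (hint _).const_mul _)
    ((hint _).const_mul _), integral_finsetSum _ fun k _ => (hint _).const_mul _]
  simp_rw [integral_const_mul]
  calc _ ≤ ∑ k ∈ range m, (1 / ((k : ℝ) + 1) - 1 / ((k : ℝ) + 2)) *
            (x * ((k : ℝ) + 1) / ((m : ℝ) + 1)) + 1 / ((m : ℝ) + 1) * x := by
        refine add_le_add (sum_le_sum fun k hk => mul_le_mul_of_nonneg_left
          (hle _ ⟨by have := hx.1; positivity, ?_⟩) (one_div_succ_sub_nonneg k))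
          (mul_le_mul_of_nonneg_left (hle _ hx) (by positivity))
        have hkm : (k : ℝ) ≤ m := by exact_mod_cast (mem_range.1 hk).le
        rw [div_le_one (by positivity)]
        have := mul_le_of_le_one_left (show (0 : ℝ) ≤ k + 1 by positivity) hx.2
        linarith
    _ = _ := by
        rw [harmonicSum, sum_range_succ', mul_add, add_div, mul_sum, sum_div]
        congr 1
        · refine sum_congr rfl fun k _ => ?_
          push_cast
          field_simp
          ring
        · simp
          ring

/-- **Hommel's inequality**: under arbitrary dependence, the Simes test based on super-uniform
p-values has level at most `x * harmonicSum s.card`. -/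
lemma measureReal_le_of_simes {Ω : Type*} [MeasurableSpace Ω] (μ : Measure Ω)
    [IsProbabilityMeasure μ] {ι : Type*} {p : ι → Ω → ℝ} (hmeas : ∀ i, Measurable (p i))
    {s : Finset ι} (hs : 0 < s.card)
    (hsup : ∀ i ∈ s, ∀ t ∈ Set.Icc (0 : ℝ) 1, μ {ω | p i ω ≤ t} ≤ ENNReal.ofReal t)
    {x : ℝ} (hx : x ∈ Set.Icc (0 : ℝ) 1) {A : Set Ω}
    (hA : ∀ ω ∈ A, ∃ T ⊆ s, 0 < T.card ∧ ∀ i ∈ T, p i ω ≤ x * (T.card : ℝ) / (s.card : ℝ)) :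
    μ.real A ≤ x * harmonicSum s.card := by
  obtain ⟨m, hm⟩ : ∃ m, s.card = m + 1 := ⟨s.card - 1, by lia⟩
  have hsub : A ⊆ {ω | 1 ≤ ∑ i ∈ s, hommelWeight m x (p i ω)} := by
    intro ω hω
    obtain ⟨T, hTs, hT, hp⟩ := hA ω hω
    obtain ⟨j, hj⟩ : ∃ j, T.card = j + 1 := ⟨T.card - 1, by lia⟩
    have hjm : j ≤ m := by have := card_le_card hTs; lia
    rw [hj, hm] at hp
    push_cast at hp
    calc (1 : ℝ) = ∑ i ∈ T, 1 / ((j : ℝ) + 1) := by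
          rw [sum_const, hj, nsmul_eq_mul]
          push_cast
          field_simp
      _ ≤ ∑ i ∈ T, hommelWeight m x (p i ω) :=
          sum_le_sum fun i hi => one_div_le_hommelWeight hjm hx.1 (hp i hi)
      _ ≤ _ := sum_le_sum_of_subset_of_nonneg hTs fun i _ _ => hommelWeight_nonneg _ _ _
  have hmarkov := mul_meas_ge_le_integral_of_nonneg (μ := μ)
    (f := fun ω => ∑ i ∈ s, hommelWeight m x (p i ω))
    (Filter.Eventually.of_forall fun ω => sum_nonneg fun i _ => hommelWeight_nonneg _ _ _)
    (integrable_finsetSum _ fun i _ => integrable_hommelWeight_comp μ (hmeas i) m x) 1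
  rw [one_mul, integral_finsetSum _ fun i _ => integrable_hommelWeight_comp μ (hmeas i) m x]
    at hmarkov
  calc μ.real A ≤ _ := measureReal_mono hsub
    _ ≤ _ := hmarkov
    _ ≤ ∑ i ∈ s, x * harmonicSum (m + 1) / ((m : ℝ) + 1) :=
        sum_le_sum fun i hi => integral_hommelWeight_le μ (hmeas i) (hsup i hi) m hx
    _ = x * harmonicSum s.card := by
        rw [sum_const, hm, nsmul_eq_mul]
        push_cast
        field_simp

lemma one_le_harmonicSum {m : ℕ} (hm : 0 < m) : 1 ≤ harmonicSum m := by
  have := single_le_sum (f := fun k : ℕ => 1 / ((k : ℝ) + 1)) (fun k _ => by positivity)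
    (mem_range.2 hm)
  simpa [harmonicSum] using this

lemma procFDP_nonneg {ι : Type*} (N₀ R : Finset ι) : 0 ≤ procFDP N₀ R := by
  unfold procFDP
  positivity

lemma procFDP_le_one {ι : Type*} (N₀ R : Finset ι) : procFDP N₀ R ≤ 1 := by
  unfold procFDP
  have h : (R ∩ N₀).card ≤ max R.card 1 := (card_le_card inter_subset_left).trans (le_max_left _ _)
  exact div_le_one_of_le₀ (by exact_mod_cast h) (by positivity)

/-- If the false discovery proportion of a compliant rejection set is at least `t`, the rejected
nulls witness a Simes rejection at level `α * π₀ / t`. -/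
lemma IsCompliant.exists_subset_of_le_procFDP {ι : Type*} [Fintype ι] {α : ℝ} (hα : 0 < α) {p : ι → ℝ}
    {N₀ R : Finset ι} (h : IsCompliant α p R) {t : ℝ} (ht : 0 < t) (htF : t ≤ procFDP N₀ R) :
    ∃ T ⊆ N₀, 0 < T.card ∧ ∀ i ∈ T,
      p i ≤ (N₀.card / Fintype.card ι * α / t) * (T.card : ℝ) / (N₀.card : ℝ) := by
  have hV : 0 < (R ∩ N₀).card := by
    by_contra! h0
    simp [procFDP, Nat.le_zero.1 h0] at htF
    linarith
  have hR : 0 < R.card := hV.trans_le (card_le_card inter_subset_left)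
  have hN : (0 : ℝ) < N₀.card := by
    exact_mod_cast hV.trans_le (card_le_card inter_subset_right)
  refine ⟨R ∩ N₀, inter_subset_right, hV, fun i hi => (h i (mem_inter.1 hi).1).trans ?_⟩
  rw [procFDP, max_eq_left (by lia), le_div_iff₀ (by exact_mod_cast hR)] at htF
  have hn : (0 : ℝ) < Fintype.card ι := by exact_mod_cast hR.trans_le (card_le_univ R)
  have hR' : (R.card : ℝ) ≤ ((R ∩ N₀).card : ℝ) / t := by
    rw [le_div_iff₀ ht]
    linarith
  calc α * (R.card : ℝ) / Fintype.card ι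
      ≤ α * (((R ∩ N₀).card : ℝ) / t) / Fintype.card ι := by gcongr
    _ = _ := by field_simp

/-- A `[0, 1]`-valued random variable with tails `μ {f ≥ t} ≤ c / t` has mean at most
`∫ t in 0..1, min 1 (c / t) = c * log (e / c)`. -/
lemma integral_le_mul_log_of_tail_le {Ω : Type*} [MeasurableSpace Ω] (μ : Measure Ω)
    [IsProbabilityMeasure μ] {f : Ω → ℝ} (hf : Measurable f) (h0 : ∀ ω, 0 ≤ f ω)
    (h1 : ∀ ω, f ω ≤ 1) {c : ℝ} (hc : 0 < c) (hc1 : c < 1)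
    (htail : ∀ t, c < t → t ≤ 1 → μ.real {ω | t ≤ f ω} ≤ c / t) :
    ∫ ω, f ω ∂μ ≤ c * Real.log (Real.exp 1 / c) := by
  have hint : Integrable f μ := Integrable.of_bound hf.aestronglyMeasurable 1
    (Filter.Eventually.of_forall fun ω => by rw [Real.norm_of_nonneg (h0 ω)]; exact h1 ω)
  rw [hint.integral_eq_integral_Ioc_meas_le (M := 1) (Filter.Eventually.of_forall h0)
    (Filter.Eventually.of_forall h1), ← intervalIntegral.integral_of_le zero_le_one]
  have hanti : Antitone fun t : ℝ => μ.real {ω | t ≤ f ω} := fun a b hab =>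
    measureReal_mono fun ω (hω : b ≤ f ω) => hab.trans hω
  rw [← intervalIntegral.integral_add_adjacent_intervals (b := c)
    hanti.intervalIntegrable hanti.intervalIntegrable]
  have hlow : ∫ t in (0 : ℝ)..c, μ.real {ω | t ≤ f ω} ≤ c := by
    calc _ ≤ ∫ _ in (0 : ℝ)..c, (1 : ℝ) :=
          intervalIntegral.integral_mono_on hc.le hanti.intervalIntegrable (by simp)
            fun t _ => measureReal_le_one
      _ = c := by simp
  have hhigh : ∫ t in c..1, μ.real {ω | t ≤ f ω} ≤ c * Real.log (1 / c) := by
    have hne : ∀ t ∈ Set.uIcc c 1, t ≠ 0 := fun t ht => by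
      rw [Set.uIcc_of_le hc1.le] at ht
      exact (hc.trans_le ht.1).ne'
    calc _ ≤ ∫ t in c..1, c * (1 / t) := by
          refine intervalIntegral.integral_mono_on_of_le_Ioo hc1.le hanti.intervalIntegrable
            ((intervalIntegral.intervalIntegrable_one_div hne continuousOn_id).const_mul c)
            fun t ht => ?_
          rw [mul_one_div]
          exact htail t ht.1 ht.2.le
      _ = _ := by
          rw [intervalIntegral.integral_const_mul, integral_one_div_of_pos hc one_pos]
  have hlog : Real.log (Real.exp 1 / c) = 1 + Real.log (1 / c) := by
    rw [Real.log_div (Real.exp_ne_zero 1) hc.ne', Real.log_exp, one_div, Real.log_inv]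
    ring
  rw [hlog]
  linarith

/-- **Improved bound under arbitrary dependence.** Assuming only super-uniformity of
the null p-values (arbitrary joint dependence), every procedure compliant at level
`α ∈ (0,1)` satisfies `FDR ≤ 1` if `α ≥ 1/(π₀ S(n₀))`, and
`FDR ≤ S(n₀) π₀ α log(e/(S(n₀) π₀ α))` if `α < 1/(π₀ S(n₀))`. -/
theorem fdr_arbitrary_dependence
    {Ω : Type*} [MeasurableSpace Ω] (μ : Measure Ω) [IsProbabilityMeasure μ]
    {n : ℕ} (hn : 0 < n) (p : Fin n → Ω → ℝ)
    (hmeas : ∀ i, Measurable (p i))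
    (hrange : ∀ i ω, p i ω ∈ Set.Icc (0:ℝ) 1)
    (N₀ : Finset (Fin n)) (hN₀ : 0 < N₀.card)
    (hnull : ∀ i ∈ N₀, ∀ t ∈ Set.Icc (0:ℝ) 1, μ {ω | p i ω ≤ t} ≤ ENNReal.ofReal t)
    {α : ℝ} (hα : 0 < α) (hα1 : α < 1)
    (proc : Ω → Finset (Fin n))
    (hcomp : ∀ ω, IsCompliant α (fun i => p i ω) (proc ω))
    (hmeasFDP : Measurable fun ω => procFDP N₀ (proc ω)) :
    (1 / ((N₀.card : ℝ) / n * harmonicSum N₀.card) ≤ α →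
        (∫ ω, procFDP N₀ (proc ω) ∂μ) ≤ 1) ∧
      (α < 1 / ((N₀.card : ℝ) / n * harmonicSum N₀.card) →
        (∫ ω, procFDP N₀ (proc ω) ∂μ) ≤
          harmonicSum N₀.card * ((N₀.card : ℝ) / n) * α *
            Real.log (Real.exp 1 / (harmonicSum N₀.card * ((N₀.card : ℝ) / n) * α))) := by
  refine ⟨fun _ => ?_, fun hlt => ?_⟩
  · have hbound := integral_mono_of_nonneg (μ := μ)
      (Filter.Eventually.of_forall fun ω => procFDP_nonneg N₀ (proc ω)) (integrable_const (1 : ℝ))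
      (Filter.Eventually.of_forall fun ω => procFDP_le_one N₀ (proc ω))
    simpa using hbound
  have hnR : (0 : ℝ) < n := by exact_mod_cast hn
  have hN : (0 : ℝ) < N₀.card := by exact_mod_cast hN₀
  have hS := one_le_harmonicSum hN₀
  have hS0 : 0 < harmonicSum N₀.card := one_pos.trans_le hS
  refine integral_le_mul_log_of_tail_le μ hmeasFDP (fun ω => procFDP_nonneg _ _)
    (fun ω => procFDP_le_one _ _) (by positivity) ?_ fun t hct ht1 => ?_
  · rw [lt_div_iff₀ (by positivity)] at hlt
    linarith
  have hx : 0 < (N₀.card : ℝ) / n * α := by positivity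
  have ht : 0 < t := lt_trans (by positivity) hct
  have hxt : (N₀.card : ℝ) / n * α ≤ t := by
    have := le_mul_of_one_le_left hx.le hS
    linarith
  refine (measureReal_le_of_simes μ hmeas hN₀ hnull (x := (N₀.card : ℝ) / n * α / t)
    ⟨by positivity, div_le_one_of_le₀ hxt ht.le⟩ fun ω hω => ?_).trans_eq (by ring)
  have hwit := (hcomp ω).exists_subset_of_le_procFDP hα ht hω
  rwa [Fintype.card_fin] at hwit
end

section
/- For every ε ∈ (0,1) there exists an integer N such that for all n ≥ N, all integers 1 ≤ j ≤ n, and all α ∈ (0, ε/4): ((n−2)/(n−1))·Φ⁻¹(1 − αj/n) − (n−1)^{−1/4} ≥ Φ⁻¹(1 − εj/(2n)), where Φ is the standard normal cumulative distribution function and Φ⁻¹ its inverse. -/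
open MeasureTheory

/-- The standard normal cumulative distribution function `Φ`. -/
noncomputable def stdNormalCDF (x : ℝ) : ℝ :=
  ((ProbabilityTheory.gaussianReal 0 1) (Set.Iic x)).toReal

/-- The inverse `Φ⁻¹` of the standard normal CDF (a genuine inverse on `(0,1)`). -/
noncomputable def stdNormalCDFInv : ℝ → ℝ := Function.invFun stdNormalCDF

/-- The survival function at `x` is the Gaussian mass of the open ray above `x`. -/
lemma one_sub_stdNormalCDF (x : ℝ) :
    1 - stdNormalCDF x = (ProbabilityTheory.gaussianReal 0 1).real (Set.Ioi x) := by
  rw [← Set.compl_Iic, probReal_compl_eq_one_sub measurableSet_Iic]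
  rfl

lemma stdNormalCDF_sub (a b : ℝ) :
    stdNormalCDF b - stdNormalCDF a =
      ∫ x in a..b, ProbabilityTheory.gaussianPDFReal 0 1 x := by
  have hΦ (x : ℝ) : stdNormalCDF x =
      ∫ t in Set.Iic x, ProbabilityTheory.gaussianPDFReal 0 1 t := by
    rw [stdNormalCDF, ProbabilityTheory.gaussianReal_apply_eq_integral _ one_ne_zero,
      ENNReal.toReal_ofReal]
    exact integral_nonneg fun t => ProbabilityTheory.gaussianPDFReal_nonneg _ _ _
  have hint := ProbabilityTheory.integrable_gaussianPDFReal 0 1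
  rw [hΦ, hΦ, intervalIntegral.integral_Iic_sub_Iic hint.integrableOn hint.integrableOn]

lemma hasDerivAt_stdNormalCDF (x : ℝ) :
    HasDerivAt stdNormalCDF (ProbabilityTheory.gaussianPDFReal 0 1 x) x := by
  have hc : Continuous (ProbabilityTheory.gaussianPDFReal 0 1) := by
    unfold ProbabilityTheory.gaussianPDFReal
    fun_prop
  have h := (hc.integral_hasStrictDerivAt 0 x).hasDerivAt.const_add (stdNormalCDF 0)
  refine h.congr_of_eventuallyEq (Filter.Eventually.of_forall fun t => ?_)
  simp only [← stdNormalCDF_sub]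
  ring

lemma continuous_stdNormalCDF : Continuous stdNormalCDF :=
  continuous_iff_continuousAt.2 fun x => (hasDerivAt_stdNormalCDF x).continuousAt

lemma strictMono_stdNormalCDF : StrictMono stdNormalCDF :=
  strictMono_of_hasDerivAt_pos hasDerivAt_stdNormalCDF
    fun x => ProbabilityTheory.gaussianPDFReal_pos 0 1 x one_ne_zero

lemma stdNormalCDF_stdNormalCDFInv {p : ℝ} (h0 : 0 < p) (h1 : p < 1) :
    stdNormalCDF (stdNormalCDFInv p) = p := by
  have hcdf : ⇑(ProbabilityTheory.cdf (ProbabilityTheory.gaussianReal 0 1)) = stdNormalCDF := by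
    ext x
    rw [ProbabilityTheory.cdf_eq_real]
    rfl
  have hbot := ProbabilityTheory.tendsto_cdf_atBot (ProbabilityTheory.gaussianReal 0 1)
  have htop := ProbabilityTheory.tendsto_cdf_atTop (ProbabilityTheory.gaussianReal 0 1)
  rw [hcdf] at hbot htop
  obtain ⟨a, ha⟩ := (hbot.eventually_lt_const h0).exists
  obtain ⟨b, hb⟩ := (htop.eventually_const_lt h1).exists
  exact Function.invFun_eq
    (mem_range_of_exists_le_of_exists_ge continuous_stdNormalCDF ⟨a, ha.le⟩ ⟨b, hb.le⟩)

lemma stdNormalCDF_zero : stdNormalCDF 0 = 1 / 2 := by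
  have hΦ : stdNormalCDF 0 = (ProbabilityTheory.gaussianReal 0 1).real (Set.Ioi 0) := by
    have hneg := ProbabilityTheory.gaussianReal_map_neg (μ := 0) (v := 1)
    rw [neg_zero] at hneg
    have : NullSingletonClass (ProbabilityTheory.gaussianReal 0 1) :=
      ProbabilityTheory.nullSingletonClass_gaussianReal one_ne_zero
    rw [measureReal_congr Ioi_ae_eq_Ici, stdNormalCDF, ← hneg,
      Measure.map_apply measurable_neg measurableSet_Iic, hneg]
    simp [measureReal_def]
  linarith [one_sub_stdNormalCDF 0]

lemma gaussianPDFReal_anti {a b : ℝ} (ha : 0 ≤ a) (hab : a ≤ b) :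
    ProbabilityTheory.gaussianPDFReal 0 1 b ≤ ProbabilityTheory.gaussianPDFReal 0 1 a := by
  simp only [ProbabilityTheory.gaussianPDFReal, sub_zero]
  gcongr

lemma stdNormalCDF_sub_le {a b : ℝ} (ha : 0 ≤ a) (hab : a < b) :
    stdNormalCDF b - stdNormalCDF a ≤ ProbabilityTheory.gaussianPDFReal 0 1 a * (b - a) := by
  obtain ⟨c, hc, h⟩ := exists_hasDerivAt_eq_slope stdNormalCDF _ hab
    continuous_stdNormalCDF.continuousOn fun x _ => hasDerivAt_stdNormalCDF x
  rw [eq_div_iff (sub_pos.2 hab).ne'] at h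
  rw [← h]
  refine mul_le_mul_of_nonneg_right ?_ (sub_pos.2 hab).le
  exact gaussianPDFReal_anti ha hc.1.le

lemma le_stdNormalCDF_sub {a b : ℝ} (ha : 0 ≤ a) (hab : a < b) :
    ProbabilityTheory.gaussianPDFReal 0 1 b * (b - a) ≤ stdNormalCDF b - stdNormalCDF a := by
  obtain ⟨c, hc, h⟩ := exists_hasDerivAt_eq_slope stdNormalCDF _ hab
    continuous_stdNormalCDF.continuousOn fun x _ => hasDerivAt_stdNormalCDF x
  rw [eq_div_iff (sub_pos.2 hab).ne'] at h
  rw [← h]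
  refine mul_le_mul_of_nonneg_right ?_ (sub_pos.2 hab).le
  exact gaussianPDFReal_anti (ha.trans hc.1.le) hc.2.le

/-- A Mills ratio bound for the standard Gaussian. -/
lemma gaussianPDFReal_le_mul_one_sub_stdNormalCDF {y : ℝ} (hy : 0 ≤ y) :
    ProbabilityTheory.gaussianPDFReal 0 1 y ≤ 8 * (1 + y) * (1 - stdNormalCDF y) := by
  set h := 1 / (1 + y) with hh
  have h0 : 0 < h := by positivity
  have hm : h * (1 + y) = 1 := by rw [hh]; field_simp
  have h1 : h ≤ 1 := by nlinarith
  have hlow := le_stdNormalCDF_sub hy (lt_add_of_pos_right y h0)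
  have htail : 0 ≤ 1 - stdNormalCDF (y + h) := by
    rw [one_sub_stdNormalCDF]
    positivity
  have hexp : Real.exp 2 ≤ 8 := by
    have := Real.exp_one_lt_d9
    have h2 : Real.exp 2 = Real.exp 1 * Real.exp 1 := by rw [← Real.exp_add]; norm_num
    nlinarith [Real.exp_pos 1]
  have hpdf : ProbabilityTheory.gaussianPDFReal 0 1 y ≤
      8 * ProbabilityTheory.gaussianPDFReal 0 1 (y + h) := by
    have hle : ProbabilityTheory.gaussianPDFReal 0 1 y ≤
        Real.exp 2 * ProbabilityTheory.gaussianPDFReal 0 1 (y + h) := by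
      simp only [ProbabilityTheory.gaussianPDFReal]
      rw [mul_left_comm, ← Real.exp_add]
      gcongr
      simp only [NNReal.coe_one, sub_zero]
      nlinarith
    exact hle.trans (mul_le_mul_of_nonneg_right hexp
      (ProbabilityTheory.gaussianPDFReal_nonneg _ _ _))
  rw [add_sub_cancel_left] at hlow
  have hT : ProbabilityTheory.gaussianPDFReal 0 1 (y + h) * h ≤ 1 - stdNormalCDF y := by linarith
  calc ProbabilityTheory.gaussianPDFReal 0 1 y
      ≤ 8 * ProbabilityTheory.gaussianPDFReal 0 1 (y + h) := hpdf
    _ = 8 * (1 + y) * (ProbabilityTheory.gaussianPDFReal 0 1 (y + h) * h) := by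
        linear_combination (-8 * ProbabilityTheory.gaussianPDFReal 0 1 (y + h)) * hm
    _ ≤ 8 * (1 + y) * (1 - stdNormalCDF y) := by gcongr

/-- A Chernoff bound for the standard Gaussian tail. -/
lemma one_sub_stdNormalCDF_le_exp (y : ℝ) : 1 - stdNormalCDF y ≤ Real.exp (1 / 2 - y) := by
  have hint : Integrable (fun x : ℝ => Real.exp (1 * id x))
      (ProbabilityTheory.gaussianReal 0 1) :=
    ProbabilityTheory.integrable_exp_mul_gaussianReal 1
  have h := ProbabilityTheory.measure_ge_le_exp_mul_mgf y zero_le_one hint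
  rw [ProbabilityTheory.mgf_id_gaussianReal, ← Real.exp_add] at h
  rw [one_sub_stdNormalCDF]
  refine (measureReal_mono fun x hx => ?_).trans (h.trans_eq ?_)
  · exact (Set.mem_Ioi.1 hx).le
  · congr 1
    norm_num
    ring

/-- Moving a little to the right of `y` at most halves the Gaussian tail. -/
lemma half_one_sub_stdNormalCDF_le {y z : ℝ} (hy : 0 ≤ y) (hyz : y < z)
    (h : 16 * (1 + y) * (z - y) ≤ 1) :
    (1 - stdNormalCDF y) / 2 ≤ 1 - stdNormalCDF z := by
  have hT : 0 ≤ 1 - stdNormalCDF y := by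
    rw [one_sub_stdNormalCDF]
    positivity
  have h1 := stdNormalCDF_sub_le hy hyz
  have h2 := mul_le_mul_of_nonneg_right (gaussianPDFReal_le_mul_one_sub_stdNormalCDF hy)
    (sub_pos.2 hyz).le
  nlinarith [mul_le_mul_of_nonneg_right h hT]

lemma eventually_log_le_rpow (c : ℝ) :
    ∀ᶠ m : ℝ in Filter.atTop, c + Real.log m ≤ m ^ (1 / 8 : ℝ) / 5 := by
  have h1 := (isLittleO_log_rpow_atTop (r := 1 / 8) (by norm_num)).bound
    (show (0 : ℝ) < 1 / 10 by norm_num)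
  have h2 := (tendsto_rpow_atTop (y := 1 / 8) (by norm_num)).eventually_ge_atTop (10 * c)
  filter_upwards [h1, h2, Filter.eventually_ge_atTop 1] with m hm1 hm2 hm
  rw [Real.norm_of_nonneg (Real.log_nonneg hm), Real.norm_of_nonneg (by positivity)] at hm1
  linarith

lemma sixteen_mul_le_pow_eight_sub_one {y s : ℝ} (hy : 0 ≤ y) (hs : 1 ≤ s)
    (hys : y + 2 ≤ s / 5) : 16 * (1 + y) * (y + s ^ 6) ≤ s ^ 8 - 1 := by
  have hs6 : 1 ≤ s ^ 6 := one_le_pow₀ hs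
  calc 16 * (1 + y) * (y + s ^ 6)
      ≤ 16 * (1 + y) * ((1 + y) * s ^ 6) := by gcongr; nlinarith
    _ = 16 * ((1 + y) ^ 2 + 1) * s ^ 6 - 16 * s ^ 6 := by ring
    _ ≤ 16 * (s / 5) ^ 2 * s ^ 6 - 16 * s ^ 6 := by gcongr; nlinarith
    _ ≤ s ^ 8 - 1 := by nlinarith [show 0 ≤ s ^ 8 by positivity]

/-- For every `ε ∈ (0,1)` there exists `N` such that for all `n ≥ N`, all
`1 ≤ j ≤ n`, and all `α ∈ (0, ε/4)`:
`((n−2)/(n−1)) Φ⁻¹(1 − αj/n) − (n−1)^{−1/4} ≥ Φ⁻¹(1 − εj/(2n))`. -/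
theorem gaussian_quantile_inequality :
    ∀ ε : ℝ, 0 < ε → ε < 1 → ∃ N : ℕ, ∀ n : ℕ, N ≤ n →
      ∀ j : ℕ, 1 ≤ j → j ≤ n → ∀ α : ℝ, 0 < α → α < ε / 4 →
        ((n : ℝ) - 2) / ((n : ℝ) - 1) * stdNormalCDFInv (1 - α * j / n)
            - ((n : ℝ) - 1) ^ (-(1 / 4 : ℝ))
          ≥ stdNormalCDFInv (1 - ε * j / (2 * n)) := by
  intro ε hε0 hε1
  obtain ⟨M, hM⟩ := Filter.eventually_atTop.1 (eventually_log_le_rpow (5 / 2 + Real.log (4 / ε)))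
  obtain ⟨N, hN⟩ := exists_nat_ge (max M 2 + 1)
  refine ⟨N, fun n hn j hj hjn α hα0 hα => ?_⟩
  have hnR : max M 2 + 1 ≤ (n : ℝ) := hN.trans (by exact_mod_cast hn)
  have hjR : (1 : ℝ) ≤ j := by exact_mod_cast hj
  have hjnR : (j : ℝ) ≤ n := by exact_mod_cast hjn
  obtain ⟨m, hm⟩ : ∃ m : ℝ, m = (n : ℝ) - 1 := ⟨_, rfl⟩
  have hnm : (n : ℝ) = m + 1 := by linarith
  have hmM : M ≤ m := by linarith [le_max_left M 2]
  have hm2 : 2 ≤ m := by linarith [le_max_right M 2]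
  have hn0 : (0 : ℝ) < n := by linarith
  have hlog := hM m hmM
  obtain ⟨s, hs⟩ : ∃ s : ℝ, s = m ^ (1 / 8 : ℝ) := ⟨_, rfl⟩
  rw [← hs] at hlog
  have hs1 : 1 ≤ s := hs ▸ Real.one_le_rpow (by linarith) (by norm_num)
  have hsm : s ^ 8 = m := by
    rw [hs, ← Real.rpow_natCast, ← Real.rpow_mul (by linarith)]
    norm_num
  have hδ : m ^ (-(1 / 4 : ℝ)) = 1 / s ^ 2 := by
    rw [hs, ← Real.rpow_natCast, ← Real.rpow_mul (by linarith), Real.rpow_neg (by linarith)]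
    norm_num
  obtain ⟨u, hu⟩ : ∃ u : ℝ, u = ε * j / (2 * n) := ⟨_, rfl⟩
  have hu_half : u < 1 / 2 := by
    rw [hu, div_lt_iff₀ (by positivity)]
    nlinarith
  have hu_low : ε / (2 * n) ≤ u := by
    rw [hu]
    gcongr
    nlinarith
  have hu0 : 0 < u := lt_of_lt_of_le (by positivity) hu_low
  have hαu : α * j / n ≤ u / 2 := by
    rw [hu, div_div, div_le_div_iff₀ hn0 (by positivity)]
    nlinarith [mul_pos (show (0 : ℝ) < j by linarith) hn0]
  have hα_pos : 0 < α * j / n := by positivity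
  rw [← hu, show (n : ℝ) - 2 = m - 1 by linarith, ← hm, hδ]
  obtain ⟨y, hy⟩ : ∃ y, y = stdNormalCDFInv (1 - u) := ⟨_, rfl⟩
  obtain ⟨x, hx⟩ : ∃ x, x = stdNormalCDFInv (1 - α * j / n) := ⟨_, rfl⟩
  have hΦy : stdNormalCDF y = 1 - u :=
    hy ▸ stdNormalCDF_stdNormalCDFInv (by linarith) (by linarith)
  have hΦx : stdNormalCDF x = 1 - α * j / n :=
    hx ▸ stdNormalCDF_stdNormalCDFInv (by linarith) (by linarith)
  rw [← hx, ← hy]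
  have hy0 : 0 ≤ y := by
    rw [← strictMono_stdNormalCDF.le_iff_le, stdNormalCDF_zero, hΦy]
    linarith
  have hyA : y + 2 ≤ s / 5 := by
    have h1 := one_sub_stdNormalCDF_le_exp y
    have h2 : ε / (4 * m) ≤ Real.exp (1 / 2 - y) := by
      refine le_trans ?_ (hu_low.trans (by linarith))
      exact div_le_div_of_nonneg_left hε0.le (by positivity) (by linarith)
    have h4 := (Real.log_le_iff_le_exp (by positivity)).2 h2
    rw [show ε / (4 * m) = (4 / ε * m)⁻¹ by field_simp, Real.log_inv,
      Real.log_mul (by positivity) (by positivity)] at h4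
    linarith
  have hm1 : 0 < m - 1 := by linarith
  set z := (y + 1 / s ^ 2) * m / (m - 1) with hz
  have hzy : z - y = (y + m / s ^ 2) / (m - 1) := by
    rw [hz]
    field_simp
    ring
  have hms : m / s ^ 2 = s ^ 6 := by
    rw [← hsm]
    field_simp
  have hzy0 : y < z := by
    rw [← sub_pos, hzy]
    positivity
  have hsmall : 16 * (1 + y) * (z - y) ≤ 1 := by
    rw [hzy, hms, mul_div_assoc', div_le_one hm1, ← hsm]
    exact sixteen_mul_le_pow_eight_sub_one hy0 hs1 hyA
  have hzx : z ≤ x := by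
    rw [← strictMono_stdNormalCDF.le_iff_le, hΦx]
    have := half_one_sub_stdNormalCDF_le hy0 hzy0 hsmall
    rw [hΦy] at this
    linarith
  have hfin : (m - 1) / m * z = y + 1 / s ^ 2 := by
    rw [hz]
    field_simp
  have := mul_le_mul_of_nonneg_left hzx (show 0 ≤ (m - 1) / m by positivity)
  linarith
end
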